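/- For every p ∈ {0} ∪ [1,∞), the set L^SIT_p(λ^N) of p-integrable strictly triangular increasing maps is dense in the set L^IT_p(λ^N) of p-integrable triangular increasing maps with respect to the L_p(λ^N; ℝ^N) distance. -/

import Mathlib

open MeasureTheory ProbabilityTheory Filter Set
open scoped ENNReal NNReal Topology

/-- Lebesgue measure on `(0,1)`. -/
noncomputable def lambda01 : Measure ℝ := volume.restrict (Set.Ioo (0:ℝ) 1)

/-- The `N`-fold product of Lebesgue measure on `(0,1)`. -/
noncomputable def lambdaN (N : ℕ) : Measure (Fin N → ℝ) :=
  Measure.pi fun _ => lambda01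

/-- The open unit cube `(0,1)^N`. -/
def cube (N : ℕ) : Set (Fin N → ℝ) := {u | ∀ i, u i ∈ Set.Ioo (0:ℝ) 1}

/-- A map is triangular (adapted) if its `k`-th component depends only on the first `k`
coordinates. -/
def Triangular {N : ℕ} (Q : (Fin N → ℝ) → Fin N → ℝ) : Prop :=
  ∀ (k : Fin N) (u v : Fin N → ℝ), (∀ j ≤ k, u j = v j) → Q u k = Q v k

/-- Monotonicity condition (inc) on a set `s`: the `k`-th component is increasing in the
`k`-th coordinate (the earlier coordinates being fixed). -/
def IncOn {N : ℕ} (Q : (Fin N → ℝ) → Fin N → ℝ) (s : Set (Fin N → ℝ)) : Prop :=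
  ∀ k : Fin N, ∀ u ∈ s, ∀ v ∈ s, (∀ j < k, u j = v j) → u k ≤ v k → Q u k ≤ Q v k

/-- Strict monotonicity condition (sinc) on a set `s`. -/
def StrictIncOn {N : ℕ} (Q : (Fin N → ℝ) → Fin N → ℝ) (s : Set (Fin N → ℝ)) : Prop :=
  ∀ k : Fin N, ∀ u ∈ s, ∀ v ∈ s, (∀ j < k, u j = v j) → u k < v k → Q u k < Q v k

/-- Consistency condition (con) on a set `s`: if changing only the `k`-th coordinate does not
change the `k`-th component, then it does not change any later component `m ≥ k`. -/
def ConOn {N : ℕ} (Q : (Fin N → ℝ) → Fin N → ℝ) (s : Set (Fin N → ℝ)) : Prop :=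
  ∀ k m : Fin N, k ≤ m → ∀ u ∈ s, ∀ v ∈ s, (∀ j ≠ k, u j = v j) →
    Q u k = Q v k → Q u m = Q v m

/-- A quantile process: a Borel triangular map satisfying (inc) and (con) on the unit cube. -/
structure IsQuantileProcess {N : ℕ} (Q : (Fin N → ℝ) → Fin N → ℝ) : Prop where
  measurable : Measurable Q
  triangular : Triangular Q
  inc : IncOn Q (cube N)
  con : ConOn Q (cube N)

/-- The (a.e. unique) quantile process of `μ`, chosen via Hilbert's epsilon operator. -/
noncomputable def quantileProcess {N : ℕ} (μ : Measure (Fin N → ℝ)) :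
    (Fin N → ℝ) → Fin N → ℝ :=
  Classical.epsilon fun Q => IsQuantileProcess Q ∧ (lambdaN N).map Q = μ

/-- The cost `|x - y|_p^p = ∑ₖ |xₖ - yₖ|^p`, valued in `ℝ≥0∞`. -/
noncomputable def pCost (p : ℝ) {N : ℕ} (x y : Fin N → ℝ) : ℝ≥0∞ :=
  ∑ k, ENNReal.ofReal (|x k - y k| ^ p)

/-- The bounded cost `|x - y| ∧ 1` used for `p = 0`. -/
noncomputable def cost0 {N : ℕ} (x y : Fin N → ℝ) : ℝ≥0∞ :=
  ENNReal.ofReal (min ‖x - y‖ 1)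

/-- The `L_p(λ^N; ℝ^N)`-distance of two maps `(0,1)^N → ℝ^N`
(for `p = 0` the distance `∫ |f - g| ∧ 1 dλ^N` of convergence in probability). -/
noncomputable def Ldist (p : ℝ) {N : ℕ} (f g : (Fin N → ℝ) → Fin N → ℝ) : ℝ≥0∞ :=
  if p = 0 then ∫⁻ u, cost0 (f u) (g u) ∂(lambdaN N)
  else (∫⁻ u, pCost p (f u) (g u) ∂(lambdaN N)) ^ p⁻¹

/-- `μ ∈ P_p(ℝ^N)`: a Borel probability measure with finite `p`-th moments
(no moment condition when `p = 0`). -/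
def MemPp (p : ℝ) {N : ℕ} (μ : Measure (Fin N → ℝ)) : Prop :=
  IsProbabilityMeasure μ ∧
    (p = 0 ∨ ∫⁻ x, ∑ k, ENNReal.ofReal (|x k| ^ p) ∂μ < ⊤)

/-- `T` is `p`-integrable w.r.t. `λ^N` (no condition when `p = 0`). -/
def FinLp (p : ℝ) {N : ℕ} (T : (Fin N → ℝ) → Fin N → ℝ) : Prop :=
  p = 0 ∨ ∫⁻ u, ∑ k, ENNReal.ofReal (|T u k| ^ p) ∂(lambdaN N) < ⊤

/-- The Knothe–Rosenblatt distance `KR_p(μ,ν)` (for `p = 0` the metric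
`∫ |Q^μ - Q^ν| ∧ 1 dλ^N`). -/
noncomputable def KRdist (p : ℝ) {N : ℕ} (μ ν : Measure (Fin N → ℝ)) : ℝ≥0∞ :=
  Ldist p (quantileProcess μ) (quantileProcess ν)

/-- An increasing triangular transformation: a Borel triangular map satisfying (inc) on a
`λ^N`-full subset of the unit cube. -/
def IncreasingTriangular {N : ℕ} (T : (Fin N → ℝ) → Fin N → ℝ) : Prop :=
  Measurable T ∧ Triangular T ∧
    ∃ Γ : Set (Fin N → ℝ), Γ ⊆ cube N ∧ lambdaN N Γᶜ = 0 ∧ IncOn T Γ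

/-- A strictly increasing triangular transformation: a Borel triangular map satisfying (sinc)
on a `λ^N`-full subset of the unit cube. -/
def StrictlyIncreasingTriangular {N : ℕ} (T : (Fin N → ℝ) → Fin N → ℝ) : Prop :=
  Measurable T ∧ Triangular T ∧
    ∃ Γ : Set (Fin N → ℝ), Γ ⊆ cube N ∧ lambdaN N Γᶜ = 0 ∧ StrictIncOn T Γ

instance isProbabilityMeasure_lambda01 : IsProbabilityMeasure lambda01 :=
  ⟨by simp [lambda01]⟩

instance isProbabilityMeasure_lambdaN (N : ℕ) : IsProbabilityMeasure (lambdaN N) := by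
  unfold lambdaN; infer_instance

/-- Adding a positive multiple of the identity turns an increasing triangular map into a
strictly increasing one. -/
theorem IncreasingTriangular.add_smul {N : ℕ} {T : (Fin N → ℝ) → Fin N → ℝ}
    (hT : IncreasingTriangular T) {δ : ℝ} (hδ : 0 < δ) :
    StrictlyIncreasingTriangular fun u => T u + δ • u := by
  obtain ⟨hm, ht, Γ, hΓ, hΓ0, hinc⟩ := hT
  refine ⟨hm.add (measurable_id.const_smul δ), fun k u v h => ?_, Γ, hΓ, hΓ0,
    fun k u hu v hv h hlt => ?_⟩
  · simp [ht k u v h, h k le_rfl]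
  · simp only [Pi.add_apply, Pi.smul_apply, smul_eq_mul]
    exact add_lt_add_of_le_of_lt (hinc k u hu v hv h hlt.le) (by gcongr)

theorem IncreasingTriangular.ae_mem_cube {N : ℕ} {T : (Fin N → ℝ) → Fin N → ℝ}
    (hT : IncreasingTriangular T) : ∀ᵐ u ∂lambdaN N, u ∈ cube N := by
  obtain ⟨-, -, Γ, hΓ, hΓ0, -⟩ := hT
  exact measure_mono_null (compl_subset_compl.2 hΓ) hΓ0

theorem abs_smul_le_of_mem_cube {N : ℕ} {u : Fin N → ℝ} (hu : u ∈ cube N) (k : Fin N)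
    {δ : ℝ} (hδ : 0 ≤ δ) : |(δ • u) k| ≤ δ := by
  have := hu k
  rw [Pi.smul_apply, smul_eq_mul, abs_of_nonneg (mul_nonneg hδ this.1.le)]
  exact mul_le_of_le_one_right hδ this.2.le

theorem ofReal_abs_add_rpow_le {p : ℝ} (hp : 1 ≤ p) (a b : ℝ) :
    ENNReal.ofReal (|a + b| ^ p) ≤
      2 ^ (p - 1) * (ENNReal.ofReal (|a| ^ p) + ENNReal.ofReal (|b| ^ p)) := by
  have hp0 : 0 ≤ p := by linarith
  simp only [← ENNReal.ofReal_rpow_of_nonneg (abs_nonneg _) hp0]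
  refine le_trans ?_ (ENNReal.rpow_add_le_mul_rpow_add_rpow _ _ hp)
  rw [← ENNReal.ofReal_add (abs_nonneg _) (abs_nonneg _)]
  gcongr
  exact abs_add_le a b

theorem FinLp.add_smul {N : ℕ} {p : ℝ} (hp : 1 ≤ p) {T : (Fin N → ℝ) → Fin N → ℝ}
    (hTp : FinLp p T) (hcube : ∀ᵐ u ∂lambdaN N, u ∈ cube N) {δ : ℝ} (hδ : 0 ≤ δ) :
    FinLp p fun u => T u + δ • u := by
  refine Or.inr ?_
  have hTp := hTp.resolve_left (by linarith)
  have h2 : (2 : ℝ≥0∞) ^ (p - 1) ≠ ⊤ := ENNReal.rpow_ne_top_of_nonneg (by linarith) (by simp)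
  calc ∫⁻ u, ∑ k, ENNReal.ofReal (|(T u + δ • u) k| ^ p) ∂lambdaN N
      ≤ ∫⁻ u, 2 ^ (p - 1) * (∑ k, ENNReal.ofReal (|T u k| ^ p)
          + N * ENNReal.ofReal (δ ^ p)) ∂lambdaN N := by
        refine lintegral_mono_ae ?_
        filter_upwards [hcube] with u hu
        calc _ ≤ ∑ k, 2 ^ (p - 1) * (ENNReal.ofReal (|T u k| ^ p) + ENNReal.ofReal (δ ^ p)) := by
              refine Finset.sum_le_sum fun k _ => (ofReal_abs_add_rpow_le hp _ _).trans ?_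
              gcongr
              exact abs_smul_le_of_mem_cube hu k hδ
          _ = _ := by simp [← Finset.mul_sum, Finset.sum_add_distrib]
    _ < ⊤ := by
        rw [lintegral_const_mul' _ _ h2, lintegral_add_right _ measurable_const]
        refine ENNReal.mul_lt_top h2.lt_top (ENNReal.add_lt_top.2 ⟨hTp, ?_⟩)
        simp [ENNReal.mul_lt_top_iff]

theorem Ldist_add_smul_le {N : ℕ} {p : ℝ} (hp : p = 0 ∨ 1 ≤ p) (T : (Fin N → ℝ) → Fin N → ℝ)
    (hcube : ∀ᵐ u ∂lambdaN N, u ∈ cube N) {δ : ℝ} (hδ : 0 ≤ δ) :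
    Ldist p T (fun u => T u + δ • u) ≤ (N + 1) * ENNReal.ofReal δ := by
  unfold Ldist
  split_ifs with h0
  · calc ∫⁻ u, cost0 (T u) (T u + δ • u) ∂lambdaN N
        ≤ ∫⁻ _, ENNReal.ofReal δ ∂lambdaN N := by
          refine lintegral_mono_ae ?_
          filter_upwards [hcube] with u hu
          refine ENNReal.ofReal_le_ofReal ((min_le_left _ _).trans ?_)
          rw [sub_add_cancel_left, norm_neg]
          exact (pi_norm_le_iff_of_nonneg hδ).2 fun k => abs_smul_le_of_mem_cube hu k hδ
      _ = 1 * ENNReal.ofReal δ := by simp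
      _ ≤ _ := by gcongr; simp
  · have hp1 := hp.resolve_left h0
    have hp0 : 0 < p := by linarith
    calc (∫⁻ u, pCost p (T u) (T u + δ • u) ∂lambdaN N) ^ p⁻¹
        ≤ (∫⁻ _, N * ENNReal.ofReal δ ^ p ∂lambdaN N) ^ p⁻¹ := by
          refine ENNReal.rpow_le_rpow (lintegral_mono_ae ?_) (by positivity)
          filter_upwards [hcube] with u hu
          calc pCost p (T u) (T u + δ • u) ≤ ∑ _k : Fin N, ENNReal.ofReal δ ^ p := by
                refine Finset.sum_le_sum fun k _ => ?_
                rw [ENNReal.ofReal_rpow_of_nonneg hδ hp0.le, Pi.add_apply, sub_add_cancel_left,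
                  abs_neg]
                gcongr
                exact abs_smul_le_of_mem_cube hu k hδ
            _ = N * ENNReal.ofReal δ ^ p := by simp
      _ = (N : ℝ≥0∞) ^ p⁻¹ * ENNReal.ofReal δ := by
          rw [lintegral_const, measure_univ, mul_one,
            ENNReal.mul_rpow_of_nonneg _ _ (by positivity), ENNReal.rpow_rpow_inv hp0.ne']
      _ ≤ (N + 1) * ENNReal.ofReal δ := by
          gcongr
          calc (N : ℝ≥0∞) ^ p⁻¹ ≤ (N + 1 : ℝ≥0∞) ^ p⁻¹ := by gcongr; simp
            _ ≤ (N + 1 : ℝ≥0∞) ^ (1 : ℝ) :=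
              ENNReal.rpow_le_rpow_of_exponent_le (by simp) (inv_le_one_of_one_le₀ hp1)
            _ = N + 1 := ENNReal.rpow_one _

/-- For `p ∈ {0} ∪ [1,∞)` the set `L^SIT_p(λ^N)` of `p`-integrable strictly
increasing triangular maps is dense in `L^IT_p(λ^N)` for the `L_p(λ^N; ℝ^N)` distance. -/
theorem LSIT_dense_in_LIT (N : ℕ) (p : ℝ) (hp : p = 0 ∨ 1 ≤ p)
    (T : (Fin N → ℝ) → Fin N → ℝ) (hT : IncreasingTriangular T) (hTp : FinLp p T)
    (ε : ℝ≥0∞) (hε : 0 < ε) :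
    ∃ S : (Fin N → ℝ) → Fin N → ℝ,
      StrictlyIncreasingTriangular S ∧ FinLp p S ∧ Ldist p T S < ε := by
  have hN : (N + 1 : ℝ≥0∞) ≠ ⊤ := by simp
  obtain ⟨δ, hδ0, hδ⟩ := ENNReal.lt_iff_exists_nnreal_btwn.1 (ENNReal.div_pos hε.ne' hN)
  have hδ0 : 0 < (δ : ℝ) := by exact_mod_cast hδ0
  refine ⟨fun u => T u + (δ : ℝ) • u, hT.add_smul hδ0, ?_, ?_⟩
  · exact hp.elim Or.inl fun hp1 => hTp.add_smul hp1 hT.ae_mem_cube hδ0.le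
  · refine (Ldist_add_smul_le hp T hT.ae_mem_cube hδ0.le).trans_lt ?_
    rw [ENNReal.ofReal_coe_nnreal, mul_comm]
    exact (ENNReal.lt_div_iff_mul_lt (by simp) (by simp)).1 hδ
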